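/- arXiv:2504.06686 — 2 statements merged into one kernel-verified Lean document; each statement's English description precedes it below -/
import Mathlib

section
/- Let 𝒫 and 𝒬 be convex sets of probability measures on (Ω,ℱ) with 𝒬 ≪≪ 𝒫, and fix ε, δ > 0. Suppose that for each A ∈ ℱ such that there exists P ∈ 𝒫 with P(A) < δ, there exists Q ∈ 𝒬 with Q(A) < ε. Then for every fixed P ∈ 𝒫: sup over h ∈ D̃^{εδ,P} of inf over Q ∈ 𝒬 of E_Q[h] is at most 2ε. -/
open MeasureTheory Filter Topology
open scoped ENNReal NNReal

namespace RobustHS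


variable {Ω : Type*} [MeasurableSpace Ω]

/-- A property `p` holds `Ps`-quasi-surely if it holds outside of a measurable set which is
null for every measure in `Ps` (equivalently, outside of a polar set). -/
def QS (Ps : Set (Measure Ω)) (p : Ω → Prop) : Prop :=
  ∃ N : Set Ω, MeasurableSet N ∧ (∀ P ∈ Ps, P N = 0) ∧ ∀ ω, ω ∉ N → p ω

/-- Convexity of a set of measures. -/
def MConvex (Ps : Set (Measure Ω)) : Prop :=
  ∀ P ∈ Ps, ∀ P' ∈ Ps, ∀ t : ℝ≥0∞, t ≤ 1 → t • P + (1 - t) • P' ∈ Ps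

/-- `Qs ≪≪ Ps` : every `Q ∈ Qs` is absolutely continuous with respect to some `P ∈ Ps`. -/
def DominatedBy (Qs Ps : Set (Measure Ω)) : Prop := ∀ Q ∈ Qs, ∃ P ∈ Ps, Q ≪ P

/-- The underlying set of the space `E`: all finite signed measures which are absolutely
continuous with respect to at least one `P ∈ Ps`. -/
def Edom (Ps : Set (Measure Ω)) : Set (SignedMeasure Ω) :=
  {μ | ∃ P ∈ Ps, μ ≪ᵥ P.toENNRealVectorMeasure}

/-- The total variation norm of a finite signed measure. -/
noncomputable def tvnorm (μ : SignedMeasure Ω) : ℝ := (μ.totalVariation Set.univ).toReal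

/-- A nonempty convex set of probability measures on `Ω`. -/
structure ConvexProbFamily (Ω : Type*) [MeasurableSpace Ω] where
  sets : Set (Measure Ω)
  nonempty : sets.Nonempty
  isProb : ∀ P ∈ sets, IsProbabilityMeasure P
  convex : MConvex sets

/-- The space `E` as a submodule of the signed measures on `Ω`. -/
noncomputable def Esub (C : ConvexProbFamily Ω) : Submodule ℝ (SignedMeasure Ω) where
  carrier := Edom C.sets
  zero_mem' := by
    obtain ⟨P, hP⟩ := C.nonempty
    exact ⟨P, hP, fun s _ => rfl⟩
  add_mem' := by
    rintro μ₁ μ₂ ⟨P₁, hP₁, hac₁⟩ ⟨P₂, hP₂, hac₂⟩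
    refine ⟨(2⁻¹ : ℝ≥0∞) • P₁ + (1 - 2⁻¹ : ℝ≥0∞) • P₂,
      C.convex P₁ hP₁ P₂ hP₂ 2⁻¹ (by simp [ENNReal.inv_le_one]), ?_⟩
    intro s hs
    rw [VectorMeasure.add_apply]
    by_cases hm : MeasurableSet s
    · rw [Measure.toENNRealVectorMeasure_apply_measurable hm, Measure.add_apply,
        Measure.smul_apply, Measure.smul_apply, smul_eq_mul, smul_eq_mul,
        add_eq_zero, mul_eq_zero, mul_eq_zero] at hs
      have h1 : P₁ s = 0 := by
        rcases hs.1 with h | h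
        · exact absurd h (by simp)
        · exact h
      have h2 : P₂ s = 0 := by
        rcases hs.2 with h | h
        · exact absurd h (by simp [ENNReal.one_sub_inv_two])
        · exact h
      rw [hac₁ (by rw [Measure.toENNRealVectorMeasure_apply_measurable hm]; exact h1),
        hac₂ (by rw [Measure.toENNRealVectorMeasure_apply_measurable hm]; exact h2), add_zero]
    · rw [VectorMeasure.not_measurable _ hm, VectorMeasure.not_measurable _ hm, add_zero]
  smul_mem' := by
    rintro c μ ⟨P, hP, hac⟩
    exact ⟨P, hP, fun s hs => by rw [VectorMeasure.smul_apply, hac hs, smul_zero]⟩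



theorem exists_hahn (s : SignedMeasure Ω) :
    ∃ i : Set Ω, MeasurableSet i ∧ (0 ≤[i] s) ∧ (s ≤[iᶜ] 0) ∧ tvnorm s = s i - s iᶜ := by
  obtain ⟨i, hi₁, hi₂, hi₃, hpos, hneg⟩ := s.toJordanDecomposition_spec
  refine ⟨i, hi₁, hi₂, hi₃, ?_⟩
  rw [tvnorm, SignedMeasure.totalVariation, Measure.add_apply, hpos, hneg,
    SignedMeasure.toMeasureOfZeroLE_apply _ hi₂ hi₁ MeasurableSet.univ,
    SignedMeasure.toMeasureOfLEZero_apply _ hi₃ hi₁.compl MeasurableSet.univ]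
  rw [← ENNReal.coe_add, ENNReal.coe_toReal, NNReal.coe_add, NNReal.coe_mk, NNReal.coe_mk]
  rw [Set.inter_univ, Set.inter_univ]
  ring

theorem apply_sub_compl_le (s : SignedMeasure Ω) {A : Set Ω} (hA : MeasurableSet A) :
    s A - s Aᶜ ≤ tvnorm s := by
  obtain ⟨i, hi₁, hi₂, hi₃, heq⟩ := exists_hahn s
  rw [heq]
  have hAi : s A = s (A ∩ i) + s (A ∩ iᶜ) := by
    conv_lhs => rw [← Set.inter_union_compl A i]
    exact s.of_union (Set.disjoint_of_subset Set.inter_subset_right Set.inter_subset_right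
      disjoint_compl_right) (hA.inter hi₁) (hA.inter hi₁.compl)
  have hiA : s i = s (A ∩ i) + s (Aᶜ ∩ i) := by
    conv_lhs => rw [← Set.inter_union_compl i A, Set.inter_comm i A, Set.inter_comm i Aᶜ]
    exact s.of_union (Set.disjoint_of_subset Set.inter_subset_left Set.inter_subset_left
      disjoint_compl_right) (hA.inter hi₁) (hA.compl.inter hi₁)
  have hAci : s Aᶜ = s (Aᶜ ∩ i) + s (Aᶜ ∩ iᶜ) := by
    conv_lhs => rw [← Set.inter_union_compl Aᶜ i]
    exact s.of_union (Set.disjoint_of_subset Set.inter_subset_right Set.inter_subset_right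
      disjoint_compl_right) (hA.compl.inter hi₁) (hA.compl.inter hi₁.compl)
  have hic : s iᶜ = s (Aᶜ ∩ iᶜ) + s (A ∩ iᶜ) := by
    conv_lhs => rw [← Set.inter_union_compl iᶜ Aᶜ, Set.inter_comm iᶜ Aᶜ, Set.inter_comm iᶜ Aᶜᶜ,
      compl_compl]
    exact s.of_union (Set.disjoint_of_subset Set.inter_subset_left Set.inter_subset_left
      disjoint_compl_left) (hA.compl.inter hi₁.compl)
      (hA.inter hi₁.compl)
  have h1 : s (A ∩ iᶜ) ≤ 0 :=
    s.nonpos_of_restrict_le_zero (s.restrict_le_zero_subset hi₁.compl Set.inter_subset_right hi₃)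
  have h2 : 0 ≤ s (Aᶜ ∩ i) :=
    s.nonneg_of_zero_le_restrict (s.zero_le_restrict_subset hi₁ Set.inter_subset_right hi₂)
  have h3 : s (Aᶜ ∩ iᶜ) ≤ 0 :=
    s.nonpos_of_restrict_le_zero (s.restrict_le_zero_subset hi₁.compl Set.inter_subset_right hi₃)
  linarith

theorem tvnorm_add_le (s t : SignedMeasure Ω) : tvnorm (s + t) ≤ tvnorm s + tvnorm t := by
  obtain ⟨i, hi₁, hi₂, hi₃, heq⟩ := exists_hahn (s + t)
  rw [heq, VectorMeasure.add_apply, VectorMeasure.add_apply]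
  have h1 := apply_sub_compl_le s hi₁
  have h2 := apply_sub_compl_le t hi₁
  linarith

theorem tvnorm_eq_zero {s : SignedMeasure Ω} (h : tvnorm s = 0) : s = 0 := by
  have hfin : s.totalVariation Set.univ ≠ ⊤ := by
    have : IsFiniteMeasure s.totalVariation := by
      rw [SignedMeasure.totalVariation]; infer_instance
    exact measure_ne_top _ _
  have hzero : s.totalVariation Set.univ = 0 := by
    rwa [tvnorm, ENNReal.toReal_eq_zero_iff, or_iff_left hfin] at h
  ext A hA
  rw [VectorMeasure.zero_apply]
  exact s.null_of_totalVariation_zero (measure_mono_null (Set.subset_univ A) hzero)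

theorem tvnorm_smul (c : ℝ) (s : SignedMeasure Ω) : tvnorm (c • s) = |c| * tvnorm s := by
  rw [tvnorm, tvnorm, SignedMeasure.totalVariation, SignedMeasure.totalVariation,
    s.toJordanDecomposition_smul_real c, JordanDecomposition.real_smul_def]
  by_cases hc : 0 ≤ c
  · rw [if_pos hc, JordanDecomposition.smul_posPart, JordanDecomposition.smul_negPart]
    rw [Measure.add_apply, Measure.add_apply, Measure.smul_apply, Measure.smul_apply,
      ← smul_add, ENNReal.toReal_smul]
    rw [abs_of_nonneg hc, NNReal.smul_def, smul_eq_mul, Real.coe_toNNReal c hc]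
  · rw [if_neg hc, JordanDecomposition.neg_posPart, JordanDecomposition.neg_negPart,
      JordanDecomposition.smul_posPart, JordanDecomposition.smul_negPart]
    rw [Measure.add_apply, Measure.add_apply, Measure.smul_apply, Measure.smul_apply,
      ← smul_add, ENNReal.toReal_smul, add_comm]
    have : |c| = -c := abs_of_neg (not_le.1 hc)
    rw [this, NNReal.smul_def, smul_eq_mul,
      Real.coe_toNNReal _ (by linarith [not_le.1 hc] : (0:ℝ) ≤ -c), neg_mul]


theorem tvnorm_neg (s : SignedMeasure Ω) : tvnorm (-s) = tvnorm s := by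
  rw [tvnorm, tvnorm, SignedMeasure.totalVariation_neg]

noncomputable instance instNormedE (C : ConvexProbFamily Ω) :
    NormedAddCommGroup (Esub C) :=
  AddGroupNorm.toNormedAddCommGroup
    { toFun := fun μ => tvnorm (μ : SignedMeasure Ω)
      map_zero' := by simp [tvnorm, SignedMeasure.totalVariation_zero]
      add_le' := fun μ ν => tvnorm_add_le μ.1 ν.1
      neg' := fun μ => tvnorm_neg μ.1
      eq_zero_of_map_eq_zero' := fun μ h => Subtype.ext (tvnorm_eq_zero h) }

noncomputable instance instNormedSpaceE (C : ConvexProbFamily Ω) :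
    NormedSpace ℝ (Esub C) where
  norm_smul_le c μ := by
    have h : tvnorm ((c • μ : Esub C) : SignedMeasure Ω) = |c| * tvnorm (μ : SignedMeasure Ω) :=
      tvnorm_smul c μ.1
    calc ‖c • μ‖ = |c| * tvnorm (μ : SignedMeasure Ω) := h
    _ ≤ ‖c‖ * ‖μ‖ := by rw [Real.norm_eq_abs]; exact le_of_eq rfl

noncomputable def sintegral (h : Ω → ℝ) (μ : SignedMeasure Ω) : ℝ :=
  ∫ ω, h ω ∂μ.toJordanDecomposition.posPart - ∫ ω, h ω ∂μ.toJordanDecomposition.negPart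

def MemLinf (Ps : Set (Measure Ω)) (h : Ω → ℝ) : Prop :=
  Measurable h ∧ ∃ M : ℝ, QS Ps fun ω => |h ω| ≤ M

def Represents (C : ConvexProbFamily Ω) (y : Esub C →L[ℝ] ℝ) (h : Ω → ℝ) : Prop :=
  ∀ μ : Esub C, y μ = sintegral h (μ : SignedMeasure Ω)

def DualSurj (C : ConvexProbFamily Ω) : Prop :=
  ∀ y : Esub C →L[ℝ] ℝ, ∃ h : Ω → ℝ, MemLinf C.sets h ∧ Represents C y h

noncomputable def linfNorm (Ps : Set (Measure Ω)) (h : Ω → ℝ) : ℝ :=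
  sInf {M : ℝ | 0 ≤ M ∧ QS Ps fun ω => |h ω| ≤ M}

def LinfRep (C : ConvexProbFamily Ω) : Type _ := {f : Ω → ℝ // MemLinf C.sets f}

instance linfSetoid (C : ConvexProbFamily Ω) : Setoid (LinfRep C) where
  r f g := QS C.sets fun ω => f.1 ω = g.1 ω
  iseqv := by
    refine ⟨fun f => ⟨∅, MeasurableSet.empty, fun P _ => measure_empty, fun ω _ => rfl⟩,
      fun {f g} hfg => ?_, fun {f g k} h₁ h₂ => ?_⟩
    · obtain ⟨N, hN, hnull, h⟩ := hfg
      exact ⟨N, hN, hnull, fun ω hω => (h ω hω).symm⟩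
    · obtain ⟨N₁, hN₁, hnull₁, hh₁⟩ := h₁
      obtain ⟨N₂, hN₂, hnull₂, hh₂⟩ := h₂
      exact ⟨N₁ ∪ N₂, hN₁.union hN₂,
        fun P hP => measure_union_null (hnull₁ P hP) (hnull₂ P hP),
        fun ω hω => (hh₁ ω fun hmem => hω (Set.mem_union_left _ hmem)).trans
          (hh₂ ω fun hmem => hω (Set.mem_union_right _ hmem))⟩

def Linf (C : ConvexProbFamily Ω) : Type _ := Quotient (linfSetoid C)

theorem sintegral_congr (C : ConvexProbFamily Ω) {f g : Ω → ℝ}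
    (hfg : QS C.sets fun ω => f ω = g ω) {μ : SignedMeasure Ω} (hμ : μ ∈ Edom C.sets) :
    sintegral f μ = sintegral g μ := by
  obtain ⟨N, hN, hnull, heq⟩ := hfg
  obtain ⟨P, hP, hac⟩ := hμ
  have htv : μ.totalVariation ≪ P := by
    have := (SignedMeasure.absolutelyContinuous_ennreal_iff μ P.toENNRealVectorMeasure).mp hac
    rwa [VectorMeasure.ennrealToMeasure_toENNRealVectorMeasure] at this
  have htvN : μ.totalVariation N = 0 := htv (hnull P hP)
  rw [SignedMeasure.totalVariation, Measure.add_apply, add_eq_zero] at htvN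
  have hsub : {ω | ¬ f ω = g ω} ⊆ N := fun ω hω => by
    by_contra hN'
    exact hω (heq ω hN')
  have h1 : f =ᵐ[μ.toJordanDecomposition.posPart] g :=
    ae_iff.mpr (measure_mono_null hsub htvN.1)
  have h2 : f =ᵐ[μ.toJordanDecomposition.negPart] g :=
    ae_iff.mpr (measure_mono_null hsub htvN.2)
  rw [sintegral, sintegral, integral_congr_ae h1, integral_congr_ae h2]

noncomputable def pairing (C : ConvexProbFamily Ω) (μ : Esub C) : Linf C → ℝ :=
  Quotient.lift (fun f : LinfRep C => sintegral f.1 (μ : SignedMeasure Ω))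
    (fun _ _ hfg => sintegral_congr C hfg μ.2)

noncomputable instance instTopLinf (C : ConvexProbFamily Ω) : TopologicalSpace (Linf C) :=
  ⨅ μ : Esub C, TopologicalSpace.induced (pairing C μ) inferInstance



/-- The gain of the one-period portfolio with strategy `H`: `H · (S₁ - S₀)`. -/
def gain {d : ℕ} (H : Fin d → ℝ) (S0 : Fin d → ℝ) (S1 : Ω → Fin d → ℝ) (ω : Ω) : ℝ :=
  ∑ i, H i * (S1 ω i - S0 i)

/-- The robust no-arbitrage condition `NA(𝒫)` of Bouchard-Nutz (one-period case). -/
def NAcond (Ps : Set (Measure Ω)) {d : ℕ} (S0 : Fin d → ℝ) (S1 : Ω → Fin d → ℝ) : Prop :=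
  ∀ H : Fin d → ℝ, QS Ps (fun ω => 0 ≤ gain H S0 S1 ω) → QS Ps (fun ω => gain H S0 S1 ω = 0)

/-- The expectation `E_Q[f] = E_Q[f⁺] - E_Q[f⁻]`, valued in `EReal`, with the convention
`∞ - ∞ = -∞` (which holds for `EReal` subtraction). -/
noncomputable def convExp (Q : Measure Ω) (f : Ω → ℝ) : EReal :=
  ((∫⁻ ω, ENNReal.ofReal (f ω) ∂Q : ℝ≥0∞) : EReal) -
    ((∫⁻ ω, ENNReal.ofReal (-f ω) ∂Q : ℝ≥0∞) : EReal)

/-- The set `𝒬` of martingale measures dominated by some measure of `Ps`. -/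
def MartSet (Ps : Set (Measure Ω)) {d : ℕ} (S0 : Fin d → ℝ) (S1 : Ω → Fin d → ℝ) :
    Set (Measure Ω) :=
  {Q | IsProbabilityMeasure Q ∧ (∃ P ∈ Ps, Q ≪ P) ∧
    ∀ i : Fin d, convExp Q (fun ω => S1 ω i - S0 i) = 0}

section LargeMarket

variable {Ωs : ℕ → Type*} [∀ n, MeasurableSpace (Ωs n)]

/-- A robust large financial market: a sequence of one-period robust markets. -/
structure LargeMarket (Ωs : ℕ → Type*) [∀ n, MeasurableSpace (Ωs n)] where
  d : ℕ → ℕ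
  S0 : ∀ n, Fin (d n) → ℝ
  S1 : ∀ n, Ωs n → Fin (d n) → ℝ
  meas_S1 : ∀ n i, Measurable fun ω => S1 n ω i

/-- Asymptotic arbitrage of the first kind for the sequence of uncertainty sets `Ps`. -/
def AA1 (M : LargeMarket Ωs) (Ps : ∀ n, Set (Measure (Ωs n))) : Prop :=
  ∃ nk : ℕ → ℕ, StrictMono nk ∧
    ∃ H : ∀ k, Fin (M.d (nk k)) → ℝ, ∃ c : ℕ → ℝ,
      (∀ k, 0 < c k) ∧ Tendsto c atTop (nhds 0) ∧
      (∀ k, QS (Ps (nk k)) fun ω => -(c k) ≤ gain (H k) (M.S0 (nk k)) (M.S1 (nk k)) ω) ∧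
      ∃ α : ℝ, 0 < α ∧ ∃ Pk : ∀ k, Measure (Ωs (nk k)),
        (∀ k, Pk k ∈ Ps (nk k)) ∧
        ∀ k, ENNReal.ofReal α ≤ Pk k {ω | α ≤ gain (H k) (M.S0 (nk k)) (M.S1 (nk k)) ω}

/-- No asymptotic arbitrage of the first kind. -/
def NAA1 (M : LargeMarket Ωs) (Ps : ∀ n, Set (Measure (Ωs n))) : Prop := ¬ AA1 M Ps

/-- Asymptotic arbitrage of the second kind. -/
def AA2 (M : LargeMarket Ωs) (Ps : ∀ n, Set (Measure (Ωs n))) : Prop :=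
  ∃ nk : ℕ → ℕ, StrictMono nk ∧
    ∃ H : ∀ k, Fin (M.d (nk k)) → ℝ,
      (∀ k, QS (Ps (nk k)) fun ω => -1 ≤ gain (H k) (M.S0 (nk k)) (M.S1 (nk k)) ω) ∧
      ∃ α : ℝ, 0 < α ∧ ∃ Pk : ∀ k, Measure (Ωs (nk k)),
        (∀ k, Pk k ∈ Ps (nk k)) ∧
        Tendsto (fun k => Pk k {ω | α ≤ gain (H k) (M.S0 (nk k)) (M.S1 (nk k)) ω})
          atTop (nhds 1)

/-- No asymptotic arbitrage of the second kind. -/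
def NAA2 (M : LargeMarket Ωs) (Ps : ∀ n, Set (Measure (Ωs n))) : Prop := ¬ AA2 M Ps

/-- `(Pₙ)` is contiguous with respect to `(Qₙ)`. -/
def Contiguous (P Q : ∀ n, Measure (Ωs n)) : Prop :=
  ∀ A : ∀ n, Set (Ωs n), (∀ n, MeasurableSet (A n)) →
    Tendsto (fun n => Q n (A n)) atTop (nhds 0) → Tendsto (fun n => P n (A n)) atTop (nhds 0)

/-- The sequence of sets `R n` of probability measures is weakly contiguous
with respect to `(Pₙ)`. -/
def WeaklyContiguous (R : ∀ n, Set (Measure (Ωs n))) (P : ∀ n, Measure (Ωs n)) : Prop :=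
  ∀ ε : ℝ, 0 < ε → ∃ δ : ℝ, 0 < δ ∧ ∃ Q : ∀ n, Measure (Ωs n), (∀ n, Q n ∈ R n) ∧
    ∀ n, ∀ A : Set (Ωs n), MeasurableSet A →
      P n A < ENNReal.ofReal δ → Q n A < ENNReal.ofReal ε

end LargeMarket



theorem QS.ae {Ps : Set (Measure Ω)} {p : Ω → Prop} (hp : QS Ps p) {P Q : Measure Ω}
    (hP : P ∈ Ps) (hQ : Q ≪ P) : ∀ᵐ ω ∂Q, p ω := by
  obtain ⟨N, -, hN, h⟩ := hp
  exact ae_iff.mpr (measure_mono_null (fun ω hω => by_contra fun hn => hω (h ω hn))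
    (hQ (hN P hP)))

/-- Strict form of Markov's inequality for the strict superlevel set. -/
theorem measure_lt_of_integral_le {μ : Measure Ω} [IsFiniteMeasure μ] {h : Ω → ℝ}
    (hm : Measurable h) (hi : Integrable h μ) (h0 : 0 ≤ᵐ[μ] h) {ε δ : ℝ} (hε : 0 < ε)
    (hδ : 0 < δ) (hle : ∫ ω, h ω ∂μ ≤ ε * δ) :
    μ {ω | ε < h ω} < ENNReal.ofReal δ := by
  have hA : MeasurableSet {ω | ε < h ω} := measurableSet_lt measurable_const hm
  by_contra! hcon
  have hreal : δ ≤ μ.real {ω | ε < h ω} :=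
    (ENNReal.ofReal_le_iff_le_toReal (measure_ne_top _ _)).mp hcon
  have hind : Integrable ({ω | ε < h ω}.indicator fun _ => ε) μ :=
    (integrable_const ε).indicator hA
  have hnonneg : 0 ≤ᵐ[μ] fun ω => h ω - {ω | ε < h ω}.indicator (fun _ => ε) ω := by
    filter_upwards [h0] with ω hω
    by_cases hlt : ε < h ω
    · simpa [Set.indicator, hlt] using hlt.le
    · simpa [Set.indicator, hlt] using hω
  have hint : ∫ ω, h ω - {ω | ε < h ω}.indicator (fun _ => ε) ω ∂μ = 0 := by
    refine le_antisymm ?_ (integral_nonneg_of_ae hnonneg)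
    rw [integral_sub hi hind, integral_indicator_const ε hA, smul_eq_mul]
    nlinarith
  have hzero : ∀ᵐ ω ∂μ, ¬ ε < h ω := by
    filter_upwards [(integral_eq_zero_iff_of_nonneg_ae hnonneg (hi.sub hind)).mp hint]
      with ω hω hlt
    simp only [Set.indicator, Set.mem_ofPred_eq, hlt, if_true, Pi.zero_apply] at hω
    linarith
  have hnull : μ {ω | ε < h ω} = 0 := by simpa [ae_iff] using hzero
  rw [hnull] at hcon
  exact absurd hcon (not_le.mpr (ENNReal.ofReal_pos.mpr hδ))

theorem integral_le_add_measureReal {μ : Measure Ω} [IsProbabilityMeasure μ] {h : Ω → ℝ}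
    (hm : Measurable h) (hi : Integrable h μ) (h1 : ∀ᵐ ω ∂μ, h ω ≤ 1) {ε : ℝ} (hε : 0 ≤ ε) :
    ∫ ω, h ω ∂μ ≤ ε + μ.real {ω | ε < h ω} := by
  have hA : MeasurableSet {ω | ε < h ω} := measurableSet_lt measurable_const hm
  have hind : Integrable ({ω | ε < h ω}.indicator fun _ => (1 : ℝ)) μ :=
    (integrable_const 1).indicator hA
  calc ∫ ω, h ω ∂μ ≤ ∫ ω, ε + {ω | ε < h ω}.indicator (fun _ => (1 : ℝ)) ω ∂μ := by
        refine integral_mono_ae hi ((integrable_const ε).add hind) ?_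
        filter_upwards [h1] with ω hω
        by_cases hlt : ε < h ω
        · simp only [Set.indicator, Set.mem_ofPred_eq, hlt, if_true]
          linarith
        · simp only [Set.indicator, Set.mem_ofPred_eq, hlt, if_false]
          linarith
    _ = ε + μ.real {ω | ε < h ω} := by
        rw [integral_add (integrable_const ε) hind, integral_indicator_const _ hA]
        simp

/-- **Dual basic lemma.**  Under the dual ε-δ Halmos-Savage hypothesis,
`sup_{h ∈ D̃^{εδ,P}} inf_{Q ∈ 𝒬} E_Q[h] ≤ 2ε`; i.e. for every `h ∈ D̃^{εδ,P}` the infimum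
over `Q ∈ 𝒬` of `E_Q[h]` is at most `2ε`. -/
theorem basic_lemma_dual {Ω : Type*} [MeasurableSpace Ω] (C : ConvexProbFamily Ω)
    (Qs : Set (Measure Ω)) (hQprob : ∀ Q ∈ Qs, IsProbabilityMeasure Q)
    (hQconv : MConvex Qs) (hdom : DominatedBy Qs C.sets)
    (ε δ : ℝ) (hε : 0 < ε) (hδ : 0 < δ)
    (hHS : ∀ A : Set Ω, MeasurableSet A → (∃ P ∈ C.sets, P A < ENNReal.ofReal δ) →
      ∃ Q ∈ Qs, Q A < ENNReal.ofReal ε)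
    (P : Measure Ω) (hP : P ∈ C.sets) :
    ∀ h : Ω → ℝ, MemLinf C.sets h → QS C.sets (fun ω => 0 ≤ h ω ∧ h ω ≤ 1) →
      (∫ ω, h ω ∂P) ≤ ε * δ →
      sInf {x : ℝ | ∃ Q ∈ Qs, x = ∫ ω, h ω ∂Q} ≤ 2 * ε := by
  intro h hmem h01 hle
  have integrable_of_ae : ∀ μ : Measure Ω, IsProbabilityMeasure μ →
      (∀ᵐ ω ∂μ, 0 ≤ h ω ∧ h ω ≤ 1) → Integrable h μ := fun μ _ hμ =>
    Integrable.of_bound hmem.1.aestronglyMeasurable 1 <| by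
      filter_upwards [hμ] with ω hω
      rw [Real.norm_of_nonneg hω.1]
      exact hω.2
  have hPprob := C.isProb P hP
  have hP01 := h01.ae hP Measure.AbsolutelyContinuous.rfl
  obtain ⟨Q, hQ, hQA⟩ := hHS {ω | ε < h ω} (measurableSet_lt measurable_const hmem.1)
    ⟨P, hP, measure_lt_of_integral_le hmem.1 (integrable_of_ae P hPprob hP01)
      (hP01.mono fun _ hω => hω.1) hε hδ hle⟩
  have hQ01 : ∀ Q ∈ Qs, ∀ᵐ ω ∂Q, 0 ≤ h ω ∧ h ω ≤ 1 := fun Q hQ =>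
    let ⟨_, hP', hac⟩ := hdom Q hQ
    h01.ae hP' hac
  have hQ_prob := hQprob Q hQ
  have hbdd : BddBelow {x : ℝ | ∃ Q ∈ Qs, x = ∫ ω, h ω ∂Q} := by
    refine ⟨0, ?_⟩
    rintro _ ⟨Q', hQ', rfl⟩
    exact integral_nonneg_of_ae ((hQ01 Q' hQ').mono fun _ hω => hω.1)
  have hreal : Q.real {ω | ε < h ω} < ε :=
    (ENNReal.lt_ofReal_iff_toReal_lt (measure_ne_top _ _)).mp hQA
  have hint := integral_le_add_measureReal hmem.1 (integrable_of_ae Q hQ_prob (hQ01 Q hQ))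
    ((hQ01 Q hQ).mono fun _ hω => hω.2) hε.le
  exact (csInf_le hbdd ⟨Q, hQ, rfl⟩).trans (by linarith)

end RobustHS
end

section
/- One-period robust FTAP (Bouchard–Nutz): Let (Ω,ℱ) be a measurable space, 𝒫 a convex set of probability measures, S_0 ∈ ℝ^d deterministic and S_1: Ω → ℝ^d measurable. Then NA(𝒫) holds if and only if for all P ∈ 𝒫 there exists Q ∈ 𝒬 such that P ≪ Q. -/
open MeasureTheory Filter Topology
open scoped ENNReal NNReal

namespace RobustHS


variable {Ω : Type*} [MeasurableSpace Ω]

/-- Every finite measure is equivalent to a finite measure which integrates a given finite family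
of measurable functions. -/
theorem exists_equivalent_integrable {Ω ι : Type*} [MeasurableSpace Ω] [Fintype ι]
    (μ : Measure Ω) [IsFiniteMeasure μ] {X : ι → Ω → ℝ} (hX : ∀ i, Measurable (X i)) :
    ∃ ν : Measure Ω, IsFiniteMeasure ν ∧ μ ≪ ν ∧ ν ≪ μ ∧ ∀ i, Integrable (X i) ν := by
  set D : Ω → ℝ := fun ω => (1 + ∑ i, |X i ω|)⁻¹ with hD
  have hpos : ∀ ω, 0 < 1 + ∑ i, |X i ω| := fun ω => by positivity
  have hDpos : ∀ ω, 0 < D ω := fun ω => inv_pos.2 (hpos ω)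
  have hDm : Measurable D := by
    simp only [hD]
    fun_prop
  have hD1 : ∀ ω, D ω ≤ 1 := fun ω => by
    refine inv_le_one_of_one_le₀ ?_
    have : 0 ≤ ∑ i, |X i ω| := by positivity
    linarith
  have hDint : Integrable D μ := Integrable.of_bound hDm.aestronglyMeasurable 1
    (ae_of_all _ fun ω => by rw [Real.norm_eq_abs, abs_of_pos (hDpos ω)]; exact hD1 ω)
  refine ⟨μ.withDensity fun ω => ENNReal.ofReal (D ω), isFiniteMeasure_withDensity_ofReal hDint.2,
    withDensity_absolutelyContinuous' (by fun_prop) (ae_of_all _ fun ω => by simp [hDpos ω]),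
    withDensity_absolutelyContinuous _ _, fun i => ?_⟩
  rw [integrable_withDensity_iff_integrable_smul' (by fun_prop) (ae_of_all _ fun ω => by simp)]
  refine Integrable.of_bound (by fun_prop) 1 (ae_of_all _ fun ω => ?_)
  rw [ENNReal.toReal_ofReal (hDpos ω).le, smul_eq_mul, norm_mul, Real.norm_eq_abs,
    Real.norm_eq_abs, abs_of_pos (hDpos ω)]
  have h1 : |X i ω| ≤ ∑ i, |X i ω| :=
    Finset.single_le_sum (f := fun i => |X i ω|) (fun _ _ => abs_nonneg _) (Finset.mem_univ i)
  calc D ω * |X i ω| ≤ D ω * (1 + ∑ i, |X i ω|) := by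
        have := (hDpos ω).le
        gcongr
        linarith
    _ = 1 := inv_mul_cancel₀ (hpos ω).ne'

/-- A convex cone in a finite-dimensional space which does not contain the origin is properly
separated from the origin. -/
theorem exists_proper_separation {E : Type*} [NormedAddCommGroup E] [NormedSpace ℝ E]
    [FiniteDimensional ℝ E] {C : Set E} (hC : Convex ℝ C) (hne : C.Nonempty) (h0 : (0 : E) ∉ C)
    (hsmul : ∀ y ∈ C, ∀ t : ℝ, 0 < t → t • y ∈ C) :
    ∃ f : E →ₗ[ℝ] ℝ, (∀ y ∈ C, 0 ≤ f y) ∧ ∃ y ∈ C, 0 < f y := by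
  set W := Submodule.span ℝ C
  set D : Set W := W.subtype ⁻¹' C with hDdef
  have hD : Convex ℝ D := hC.linear_preimage W.subtype
  have hspan : Submodule.span ℝ D = ⊤ := Submodule.span_span_coe_preimage
  have hDne : D.Nonempty := by
    obtain ⟨y, hy⟩ := hne
    exact ⟨⟨y, Submodule.subset_span hy⟩, hy⟩
  have hzero : (0 : W) ∈ affineSpan ℝ D := by
    obtain ⟨y, hy⟩ := hDne
    have h2 : (2 : ℝ) • y ∈ D := hsmul _ hy 2 two_pos
    have := AffineMap.lineMap_mem (2 : ℝ) (subset_affineSpan ℝ D h2) (subset_affineSpan ℝ D hy)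
    convert this using 1
    rw [AffineMap.lineMap_apply_module]
    module
  have haff : affineSpan ℝ D = ⊤ := by
    rw [AffineSubspace.affineSpan_eq_top_iff_vectorSpan_eq_top_of_nonempty ℝ W W hDne,
      ← direction_affineSpan, eq_top_iff, ← hspan, Submodule.span_le]
    intro y hy
    have := AffineSubspace.vsub_mem_direction (subset_affineSpan ℝ D hy) hzero
    simpa using this
  have hint : (interior D).Nonempty := hD.interior_nonempty_iff_affineSpan_eq_top.2 haff
  obtain ⟨f, hf⟩ := geometric_hahn_banach_point_open hD.interior isOpen_interior
    (x := (0 : W)) fun h => h0 (by simpa [hDdef] using interior_subset h)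
  rw [map_zero] at hf
  obtain ⟨g, hg⟩ := f.toLinearMap.exists_extend
  have hgf : ∀ w : W, g w = f w := fun w => LinearMap.congr_fun hg w
  refine ⟨g, fun y hy => ?_, ?_⟩
  · have hy' : (⟨y, Submodule.subset_span hy⟩ : W) ∈ closure (interior D) := by
      rw [hD.closure_interior_eq_closure_of_nonempty_interior hint]
      exact subset_closure hy
    have hcl : closure (interior D) ⊆ {w | 0 ≤ f w} :=
      closure_minimal (fun w hw => (hf w hw).le) (isClosed_le continuous_const f.continuous)
    exact (hcl hy').trans_eq (hgf ⟨y, Submodule.subset_span hy⟩).symm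
  · obtain ⟨w, hw⟩ := hint
    have hwD : w ∈ D := interior_subset hw
    exact ⟨w, hwD, (hf w hw).trans_eq (hgf w).symm⟩

theorem convExp_eq_zero_iff {Ω : Type*} [MeasurableSpace Ω] {Q : Measure Ω} {f : Ω → ℝ}
    (hf : Measurable f) : convExp Q f = 0 ↔ Integrable f Q ∧ ∫ ω, f ω ∂Q = 0 := by
  have hfin : Integrable f Q → ∫⁻ ω, ENNReal.ofReal (f ω) ∂Q ≠ ∞ ∧
      ∫⁻ ω, ENNReal.ofReal (-f ω) ∂Q ≠ ∞ := fun h =>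
    ⟨h.lintegral_lt_top.ne, h.neg.lintegral_lt_top.ne⟩
  have hval : Integrable f Q → convExp Q f = ((∫ ω, f ω ∂Q : ℝ) : EReal) := fun h => by
    obtain ⟨ha, hb⟩ := hfin h
    rw [convExp, integral_eq_lintegral_pos_part_sub_lintegral_neg_part h, EReal.coe_sub,
      EReal.coe_ennreal_toReal ha, EReal.coe_ennreal_toReal hb]
  refine ⟨fun h => ?_, fun h => by rw [hval h.1, h.2, EReal.coe_zero]⟩
  have hi : Integrable f Q := by
    unfold convExp at h
    have hb : ∫⁻ ω, ENNReal.ofReal (-f ω) ∂Q ≠ ∞ := fun hb => by simp [hb] at h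
    have ha : ∫⁻ ω, ENNReal.ofReal (f ω) ∂Q ≠ ∞ := fun ha => by
      lift (∫⁻ ω, ENNReal.ofReal (-f ω) ∂Q) to ℝ≥0 using hb with b
      rw [ha, EReal.coe_ennreal_top, EReal.coe_nnreal_eq_coe_real, EReal.top_sub_coe] at h
      exact EReal.top_ne_zero h
    refine ⟨hf.aestronglyMeasurable, ?_⟩
    rw [hasFiniteIntegral_iff_norm]
    have hle : ∀ ω, ENNReal.ofReal ‖f ω‖ ≤ ENNReal.ofReal (f ω) + ENNReal.ofReal (-f ω) := by
      intro ω
      rcases le_total 0 (f ω) with h | h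
      · rw [Real.norm_of_nonneg h]; exact le_self_add
      · rw [Real.norm_of_nonpos h]; exact le_add_self
    refine (lintegral_mono hle).trans_lt ?_
    rw [lintegral_add_left (by fun_prop)]
    exact ENNReal.add_lt_top.2 ⟨ha.lt_top, hb.lt_top⟩
  rw [hval hi] at h
  exact ⟨hi, EReal.coe_eq_zero.1 h⟩

theorem qs_iff_forall_ae {Ω : Type*} [MeasurableSpace Ω] {Ps : Set (Measure Ω)} {p : Ω → Prop}
    (hp : MeasurableSet {ω | p ω}) : QS Ps p ↔ ∀ P ∈ Ps, ∀ᵐ ω ∂P, p ω := by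
  refine ⟨fun ⟨N, _, hN, h⟩ P hP => ?_, fun h => ⟨{ω | p ω}ᶜ, hp.compl, h, fun ω hω => ?_⟩⟩
  · exact measure_mono_null (fun ω hω => by_contra fun h' => hω (h ω h')) (hN P hP)
  · simpa using hω

section Gain

variable {Ω : Type*} [MeasurableSpace Ω] {d : ℕ} {S0 : Fin d → ℝ} {S1 : Ω → Fin d → ℝ}

theorem measurable_gain (hS1 : ∀ i, Measurable fun ω => S1 ω i) (H : Fin d → ℝ) :
    Measurable (gain H S0 S1) := by
  unfold gain
  fun_prop

theorem integrable_gain {R : Measure Ω} (hR : ∀ i, Integrable (fun ω => S1 ω i - S0 i) R)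
    (H : Fin d → ℝ) : Integrable (gain H S0 S1) R :=
  integrable_finsetSum _ fun i _ => (hR i).const_mul (H i)

theorem integral_gain {R : Measure Ω} (hR : ∀ i, Integrable (fun ω => S1 ω i - S0 i) R)
    (H : Fin d → ℝ) :
    ∫ ω, gain H S0 S1 ω ∂ R = ∑ i, H i * ∫ ω, (S1 ω i - S0 i) ∂ R := by
  unfold gain
  rw [integral_finsetSum _ fun i _ => (hR i).const_mul (H i)]
  simp_rw [integral_const_mul]

/-- The finite measures dominating `P`, dominated by some element of `Ps`, and integrating the
price increments. -/
def PriceMeasures (Ps : Set (Measure Ω)) (P : Measure Ω) (S0 : Fin d → ℝ)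
    (S1 : Ω → Fin d → ℝ) : Set (Measure Ω) :=
  {R | IsFiniteMeasure R ∧ P ≪ R ∧ (∃ P' ∈ Ps, R ≪ P') ∧
    ∀ i, Integrable (fun ω => S1 ω i - S0 i) R}

theorem exists_midpoint {Ps : Set (Measure Ω)} (hconv : MConvex Ps) {P₁ P₂ : Measure Ω}
    (h₁ : P₁ ∈ Ps) (h₂ : P₂ ∈ Ps) : ∃ P' ∈ Ps, P₁ ≪ P' ∧ P₂ ≪ P' := by
  refine ⟨_, hconv P₁ h₁ P₂ h₂ 2⁻¹ (by simp [ENNReal.inv_le_one]), ?_, ?_⟩ <;>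
  · refine Measure.AbsolutelyContinuous.mk fun s _ hs => ?_
    simp [ENNReal.one_sub_inv_two] at hs
    tauto

theorem PriceMeasures.smul_mem {Ps : Set (Measure Ω)} {P R : Measure Ω}
    (hR : R ∈ PriceMeasures Ps P S0 S1) {t : ℝ} (ht : 0 < t) :
    ENNReal.ofReal t • R ∈ PriceMeasures Ps P S0 S1 := by
  obtain ⟨hfin, hPR, ⟨P', hP', hRP'⟩, hint⟩ := hR
  refine ⟨R.smul_finite ENNReal.ofReal_ne_top, ?_, ⟨P', hP', hRP'.smul_left _⟩,
    fun i => (hint i).smul_measure ENNReal.ofReal_ne_top⟩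
  exact hPR.trans (Measure.absolutelyContinuous_smul (by simpa using ht))

theorem PriceMeasures.add_mem {Ps : Set (Measure Ω)} (hconv : MConvex Ps) {P R R' : Measure Ω}
    (hR : R ∈ PriceMeasures Ps P S0 S1) (hR' : R' ∈ PriceMeasures Ps P S0 S1) :
    R + R' ∈ PriceMeasures Ps P S0 S1 := by
  obtain ⟨hfin, hPR, ⟨P₁, hP₁, hRP₁⟩, hint⟩ := hR
  obtain ⟨hfin', -, ⟨P₂, hP₂, hRP₂⟩, hint'⟩ := hR'
  obtain ⟨P', hP', h₁, h₂⟩ := exists_midpoint hconv hP₁ hP₂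
  exact ⟨inferInstance, hPR.add_right R', ⟨P', hP', (hRP₁.trans h₁).add_left (hRP₂.trans h₂)⟩,
    fun i => (hint i).add_measure (hint' i)⟩

/-- A strategy with nonnegative expected gain under all price measures has quasi-surely
nonnegative gain. -/
theorem qs_gain_nonneg {Ps : Set (Measure Ω)} (hprob : ∀ P ∈ Ps, IsProbabilityMeasure P)
    (hconv : MConvex Ps) (hS1 : ∀ i, Measurable fun ω => S1 ω i) {P : Measure Ω} (hP : P ∈ Ps)
    {H : Fin d → ℝ}
    (hH : ∀ R ∈ PriceMeasures Ps P S0 S1, 0 ≤ ∫ ω, gain H S0 S1 ω ∂ R) :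
    QS Ps (fun ω => 0 ≤ gain H S0 S1 ω) := by
  have hgm := measurable_gain (S0 := S0) hS1 H
  rw [qs_iff_forall_ae (measurableSet_le measurable_const hgm)]
  intro P₁ hP₁
  obtain ⟨P', hP', hPP', hP₁P'⟩ := exists_midpoint hconv hP hP₁
  have := hprob P' hP'
  obtain ⟨R₀, hfin, hP'R₀, hR₀P', hint⟩ := exists_equivalent_integrable P'
    (X := fun i ω => S1 ω i - S0 i) fun i => (hS1 i).sub_const _
  refine (hP₁P'.trans hP'R₀).ae_le ?_
  set A : Set Ω := {ω | gain H S0 S1 ω < 0}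
  have hAm : MeasurableSet A := measurableSet_lt hgm measurable_const
  have hg₀ : Integrable (gain H S0 S1) R₀ := integrable_gain hint H
  have key : ∀ ε : ℝ, 0 < ε →
      0 ≤ ε * ∫ ω, gain H S0 S1 ω ∂ R₀ + ∫ ω in A, gain H S0 S1 ω ∂ R₀ := by
    intro ε hε
    obtain ⟨h1, h2, -, h4⟩ : ENNReal.ofReal ε • R₀ ∈ PriceMeasures Ps P S0 S1 :=
      PriceMeasures.smul_mem ⟨hfin, hPP'.trans hP'R₀, ⟨P', hP', hR₀P'⟩, hint⟩ hε
    have hmem : ENNReal.ofReal ε • R₀ + R₀.restrict A ∈ PriceMeasures Ps P S0 S1 :=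
      ⟨inferInstance, h2.add_right _, ⟨P', hP', (hR₀P'.smul_left _).add_left
        (Measure.absolutelyContinuous_of_le Measure.restrict_le_self |>.trans hR₀P')⟩,
        fun i => (h4 i).add_measure (hint i).restrict⟩
    have := hH _ hmem
    rwa [integral_add_measure (hg₀.smul_measure ENNReal.ofReal_ne_top) hg₀.restrict,
      integral_smul_measure, ENNReal.toReal_ofReal hε.le, smul_eq_mul] at this
  have hge : 0 ≤ ∫ ω in A, gain H S0 S1 ω ∂ R₀ := by
    have hlim : Tendsto (fun ε : ℝ => ε * ∫ ω, gain H S0 S1 ω ∂ R₀ +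
        ∫ ω in A, gain H S0 S1 ω ∂ R₀) (𝓝[>] 0) (𝓝 (0 * ∫ ω, gain H S0 S1 ω ∂ R₀ +
        ∫ ω in A, gain H S0 S1 ω ∂ R₀)) :=
      (Continuous.tendsto (by fun_prop) 0).mono_left nhdsWithin_le_nhds
    have := ge_of_tendsto hlim (eventually_mem_nhdsWithin.mono fun ε hε => key ε hε)
    simpa using this
  have hneg : 0 ≤ᵐ[R₀.restrict A] fun ω => -gain H S0 S1 ω :=
    (ae_restrict_iff' hAm).2 (ae_of_all _ fun ω hω => neg_nonneg.2 (le_of_lt hω))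
  have hzero : ∫ ω in A, -gain H S0 S1 ω ∂ R₀ = 0 := by
    have h1 := integral_nonneg_of_ae hneg
    rw [integral_neg] at h1 ⊢
    linarith
  have hae := (integral_eq_zero_iff_of_nonneg_ae hneg hg₀.restrict.neg).1 hzero
  filter_upwards [(ae_restrict_iff' hAm).1 hae] with ω hω
  by_contra hlt
  have hlt' : gain H S0 S1 ω < 0 := not_le.1 hlt
  have := hω hlt'
  simp only [Pi.zero_apply, neg_eq_zero] at this
  exact hlt'.ne this

/-- Under no arbitrage, some price measure gives zero expectation to all price increments. -/
theorem exists_priceMeasure_integral_eq_zero {Ps : Set (Measure Ω)}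
    (hprob : ∀ P ∈ Ps, IsProbabilityMeasure P) (hconv : MConvex Ps)
    (hS1 : ∀ i, Measurable fun ω => S1 ω i) (hNA : NAcond Ps S0 S1) {P : Measure Ω}
    (hP : P ∈ Ps) :
    ∃ R ∈ PriceMeasures Ps P S0 S1, ∀ i, ∫ ω, (S1 ω i - S0 i) ∂ R = 0 := by
  set m : Measure Ω → Fin d → ℝ := fun R i => ∫ ω, (S1 ω i - S0 i) ∂ R with hm
  by_contra hcon
  set C : Set (Fin d → ℝ) := m '' PriceMeasures Ps P S0 S1
  have hsmul : ∀ y ∈ C, ∀ t : ℝ, 0 < t → t • y ∈ C := by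
    rintro _ ⟨R, hR, rfl⟩ t ht
    refine ⟨_, PriceMeasures.smul_mem hR ht, funext fun i => ?_⟩
    simp only [hm, Pi.smul_apply]
    rw [integral_smul_measure, ENNReal.toReal_ofReal ht.le]
  have hadd : ∀ y ∈ C, ∀ z ∈ C, y + z ∈ C := by
    rintro _ ⟨R, hR, rfl⟩ _ ⟨R', hR', rfl⟩
    refine ⟨_, PriceMeasures.add_mem hconv hR hR', funext fun i => ?_⟩
    exact integral_add_measure (hR.2.2.2 i) (hR'.2.2.2 i)
  have hC : Convex ℝ C := convex_iff_forall_pos.2 fun y hy z hz a b ha hb _ =>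
    hadd _ (hsmul y hy a ha) _ (hsmul z hz b hb)
  have hne : C.Nonempty := by
    have := hprob P hP
    obtain ⟨R, hfin, hPR, hRP, hint⟩ := exists_equivalent_integrable P
      (X := fun i ω => S1 ω i - S0 i) fun i => (hS1 i).sub_const _
    exact ⟨_, R, ⟨hfin, hPR, ⟨P, hP, hRP⟩, hint⟩, rfl⟩
  have h0 : (0 : Fin d → ℝ) ∉ C := by
    rintro ⟨R, hR, h⟩
    exact hcon ⟨R, hR, fun i => congrFun h i⟩
  obtain ⟨f, hf, y, ⟨R, hR, rfl⟩, hfy⟩ := exists_proper_separation hC hne h0 hsmul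
  set H : Fin d → ℝ := fun i => f (Pi.single i 1)
  have hfH : ∀ R ∈ PriceMeasures Ps P S0 S1, f (m R) = ∫ ω, gain H S0 S1 ω ∂ R := by
    intro R hR
    rw [integral_gain hR.2.2.2, f.pi_apply_eq_sum_univ]
    refine Finset.sum_congr rfl fun i _ => ?_
    have hs : (fun j => if i = j then (1 : ℝ) else 0) = Pi.single i 1 := by
      ext j
      simp [Pi.single_apply, eq_comm]
    rw [hs, smul_eq_mul, mul_comm]
  have hzero := hNA H (qs_gain_nonneg hprob hconv hS1 hP fun R hR =>
    (hf _ ⟨R, hR, rfl⟩).trans_eq (hfH R hR))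
  rw [qs_iff_forall_ae (measurableSet_eq_fun (measurable_gain hS1 H) measurable_const)] at hzero
  obtain ⟨P', hP', hRP'⟩ := hR.2.2.1
  rw [hfH R hR, integral_eq_zero_of_ae (hRP'.ae_le (hzero P' hP'))] at hfy
  exact hfy.false

end Gain

/-- **One-period robust FTAP (Bouchard-Nutz).**  `NA(𝒫)` holds iff every `P ∈ 𝒫` is
dominated by some dominated martingale measure `Q ∈ 𝒬`. -/
theorem one_period_robust_FTAP {Ω : Type*} [MeasurableSpace Ω] (Ps : Set (Measure Ω))
    (hprob : ∀ P ∈ Ps, IsProbabilityMeasure P) (hconv : MConvex Ps)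
    {d : ℕ} (S0 : Fin d → ℝ) (S1 : Ω → Fin d → ℝ)
    (hS1 : ∀ i, Measurable fun ω => S1 ω i) :
    NAcond Ps S0 S1 ↔ ∀ P ∈ Ps, ∃ Q ∈ MartSet Ps S0 S1, P ≪ Q := by
  constructor
  · intro hNA P hP
    obtain ⟨R, ⟨hfin, hPR, ⟨P', hP', hRP'⟩, hint⟩, hzero⟩ :=
      exists_priceMeasure_integral_eq_zero hprob hconv hS1 hNA hP
    have := hprob P hP
    have hR0 : R ≠ 0 := by
      rintro rfl
      exact IsProbabilityMeasure.ne_zero P (Measure.absolutelyContinuous_zero_iff.1 hPR)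
    have : NeZero R := ⟨hR0⟩
    have hne : (R Set.univ)⁻¹ ≠ 0 := by simp
    have htop : (R Set.univ)⁻¹ ≠ ∞ := by simpa using hR0
    refine ⟨(R Set.univ)⁻¹ • R, ⟨inferInstance, ⟨P', hP', hRP'.smul_left _⟩, fun i => ?_⟩,
      hPR.trans (Measure.absolutelyContinuous_smul hne)⟩
    rw [convExp_eq_zero_iff ((hS1 i).sub_const _), integral_smul_measure, hzero i, smul_zero]
    exact ⟨(hint i).smul_measure htop, rfl⟩
  · intro h H hH
    have hgm := measurable_gain (S0 := S0) hS1 H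
    rw [qs_iff_forall_ae (measurableSet_le measurable_const hgm)] at hH
    rw [qs_iff_forall_ae (measurableSet_eq_fun hgm measurable_const)]
    intro P hP
    obtain ⟨Q, ⟨-, ⟨P', hP', hQP'⟩, hQ⟩, hPQ⟩ := h P hP
    have hmart := fun i => (convExp_eq_zero_iff ((hS1 i).sub_const _)).1 (hQ i)
    refine hPQ.ae_le ((integral_eq_zero_iff_of_nonneg_ae (hQP'.ae_le (hH P' hP'))
      (integrable_gain (fun i => (hmart i).1) H)).1 ?_)
    rw [integral_gain fun i => (hmart i).1]
    exact Finset.sum_eq_zero fun i _ => by rw [(hmart i).2, mul_zero]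

end RobustHS
end
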